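/- arXiv:0812.3252 — 3 statements merged into one kernel-verified Lean document; each statement's English description precedes it below -/
import Mathlib

section
/- Let c < d and a < b be real numbers, let F : [c,d] → [a,b] be a continuous strictly increasing bijection (so F(c) = a and F(d) = b), and let F_n : [c,d] → [a,b] be a sequence of nondecreasing functions such that F_n(y) → F(y) for every y ∈ [c,d]. Define the generalized inverses F_n⁻¹(t) = inf{ y ∈ [c,d] : F_n(y) ≥ t } (with the convention inf ∅ = d). Then sup_{t ∈ [a,b]} | F_n⁻¹(t) − F⁻¹(t) | → 0 as n → ∞, where F⁻¹ is the inverse of F. -/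
open Set Filter

/-- The generalized inverse is at most `d` and at most any point of `[c,d]` at which the function
reaches the level. -/
lemma sInf_insert_superlevel_le {c d t : ℝ} (hcd : c ≤ d) (G : ℝ → ℝ) {v : ℝ}
    (hv : v ∈ insert d {y | y ∈ Set.Icc c d ∧ t ≤ G y}) :
    sInf (insert d {y | y ∈ Set.Icc c d ∧ t ≤ G y}) ≤ v := by
  refine csInf_le ⟨c, ?_⟩ hv
  rintro y (rfl | hy)
  · exact hcd
  · exact hy.1.1

/-- The generalized inverse is at least any point of `[c,d]` at which the monotone function lies
below the level. -/
lemma le_sInf_insert_superlevel {c d t : ℝ} {G : ℝ → ℝ} (hG : MonotoneOn G (Set.Icc c d))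
    {u : ℝ} (hu : u ∈ Set.Icc c d) (hut : G u < t) :
    u ≤ sInf (insert d {y | y ∈ Set.Icc c d ∧ t ≤ G y}) := by
  refine le_csInf (Set.insert_nonempty _ _) ?_
  rintro y (rfl | hy)
  · exact hu.2
  · by_contra! h
    exact (hy.2.trans (hG hy.1 hu h.le)).not_gt hut

/-- Along a strictly increasing continuous pointwise limit `F`, the generalized inverses at level
`F x` converge to `x`, uniformly on `[c,d]`. -/
lemma tendstoUniformlyOn_sInf_insert_superlevel {c d : ℝ} (hcd : c ≤ d) {F : ℝ → ℝ}
    (hFc : ContinuousOn F (Set.Icc c d)) (hFm : StrictMonoOn F (Set.Icc c d)) {Fn : ℕ → ℝ → ℝ}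
    (hFn_mono : ∀ n, MonotoneOn (Fn n) (Set.Icc c d))
    (hconv : ∀ y ∈ Set.Icc c d, Tendsto (fun n => Fn n y) atTop (nhds (F y))) :
    TendstoUniformlyOn (fun n x => sInf (insert d {y | y ∈ Set.Icc c d ∧ F x ≤ Fn n y}))
      (fun x => x) atTop (Set.Icc c d) := by
  rw [← tendstoLocallyUniformlyOn_iff_tendstoUniformlyOn_of_compact isCompact_Icc,
    tendstoLocallyUniformlyOn_iff_forall_tendsto]
  intro x₀ hx₀
  rw [Metric.uniformity_basis_dist.tendsto_right_iff]
  intro ε hε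
  have hF : Tendsto (fun p : ℕ × ℝ => F p.2) (atTop ×ˢ nhdsWithin x₀ (Set.Icc c d))
      (nhds (F x₀)) := (hFc x₀ hx₀).tendsto.comp tendsto_snd
  have hFn (y : ℝ) (hy : y ∈ Set.Icc c d) :
      Tendsto (fun p : ℕ × ℝ => Fn p.1 y) (atTop ×ˢ nhdsWithin x₀ (Set.Icc c d))
        (nhds (F y)) := (hconv y hy).comp tendsto_fst
  have hnear : ∀ᶠ p : ℕ × ℝ in atTop ×ˢ nhdsWithin x₀ (Set.Icc c d), |p.2 - x₀| < ε / 2 :=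
    tendsto_snd.eventually
      (nhdsWithin_le_nhds (Metric.ball_mem_nhds x₀ (half_pos hε)))
  have hupper : ∀ᶠ p : ℕ × ℝ in atTop ×ˢ nhdsWithin x₀ (Set.Icc c d),
      sInf (insert d {y | y ∈ Set.Icc c d ∧ F p.2 ≤ Fn p.1 y}) ≤ x₀ + ε / 2 := by
    by_cases h : d ≤ x₀ + ε / 2
    · exact Eventually.of_forall fun p =>
        (sInf_insert_superlevel_le hcd (Fn p.1) (Set.mem_insert _ _)).trans h
    · have hv : x₀ + ε / 2 ∈ Set.Icc c d := ⟨by linarith [hx₀.1], by linarith⟩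
      filter_upwards [hF.eventually_lt (hFn _ hv) (hFm hx₀ hv (by linarith))] with p hp
      exact sInf_insert_superlevel_le hcd (Fn p.1) (Or.inr ⟨hv, hp.le⟩)
  have hlower : ∀ᶠ p : ℕ × ℝ in atTop ×ˢ nhdsWithin x₀ (Set.Icc c d),
      x₀ - ε / 2 ≤ sInf (insert d {y | y ∈ Set.Icc c d ∧ F p.2 ≤ Fn p.1 y}) := by
    by_cases h : x₀ - ε / 2 ≤ c
    · refine Eventually.of_forall fun p => h.trans (le_csInf (Set.insert_nonempty _ _) ?_)
      rintro y (rfl | hy)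
      · exact hcd
      · exact hy.1.1
    · have hu : x₀ - ε / 2 ∈ Set.Icc c d := ⟨by linarith, by linarith [hx₀.2]⟩
      filter_upwards [(hFn _ hu).eventually_lt hF (hFm hu hx₀ (by linarith))] with p hp
      exact le_sInf_insert_superlevel (hFn_mono p.1) hu hp
  filter_upwards [hnear, hupper, hlower] with p hp hpu hpl
  rw [abs_lt] at hp
  simp only [Real.dist_eq, abs_lt]
  constructor <;> linarith [hp.1, hp.2]

/-- If `F : [c,d] → [a,b]` is a continuous strictly increasing bijection
and `F_n : [c,d] → [a,b]` are nondecreasing with `F_n → F` pointwise on `[c,d]`, then the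
generalized inverses `F_n⁻¹(t) = inf { y ∈ [c,d] : F_n(y) ≥ t }` (with `inf ∅ = d`)
converge uniformly on `[a,b]` to the inverse `F⁻¹` of `F`. -/
theorem generalized_inverses_converge_uniformly
    {c d a b : ℝ} (hcd : c < d) (hab : a < b)
    (F : ℝ → ℝ) (hFc : ContinuousOn F (Set.Icc c d)) (hFm : StrictMonoOn F (Set.Icc c d))
    (hFa : F c = a) (hFb : F d = b)
    (Fn : ℕ → ℝ → ℝ)
    (hFn_mono : ∀ n, MonotoneOn (Fn n) (Set.Icc c d))
    (hFn_maps : ∀ n, Set.MapsTo (Fn n) (Set.Icc c d) (Set.Icc a b))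
    (hconv : ∀ y ∈ Set.Icc c d, Tendsto (fun n => Fn n y) atTop (nhds (F y)))
    (Finv : ℝ → ℝ)
    (hFinv : ∀ t ∈ Set.Icc a b, Finv t ∈ Set.Icc c d ∧ F (Finv t) = t) :
    Tendsto (fun n => ⨆ t : Set.Icc a b,
        |sInf (insert d {y | y ∈ Set.Icc c d ∧ (t : ℝ) ≤ Fn n y}) - Finv t|)
      atTop (nhds 0) := by
  have huni := tendstoUniformlyOn_sInf_insert_superlevel hcd.le hFc hFm hFn_mono hconv
  rw [Metric.tendstoUniformlyOn_iff] at huni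
  rw [Metric.tendsto_nhds]
  intro ε hε
  filter_upwards [huni (ε / 2) (half_pos hε)] with n hn
  rw [Real.dist_0_eq_abs, abs_of_nonneg (Real.iSup_nonneg fun _ => abs_nonneg _)]
  refine (Real.iSup_le (fun t => ?_) (half_pos hε).le).trans_lt (half_lt_self hε)
  obtain ⟨hmem, heq⟩ := hFinv t t.2
  have h := hn (Finv t) hmem
  rw [heq, dist_comm, Real.dist_eq] at h
  exact h.le
end

section
/- Let f : [a,b] → ℝ be continuous and strictly increasing, let h and h₀ be continuous strictly increasing bijections of [a,b] onto itself with h(a) = h₀(a) = a and h(b) = h₀(b) = b, and let n ≥ 1 be an integer with grid points t_j = a + j(b−a)/n, j = 0, …, n. Let t ∈ [a + (b−a)/n, b − (b−a)/n], let j₀ be an index minimizing |t_j − t| over j ∈ {0, …, n}, and let T = t_{j*} where j* is any index minimizing | f(h⁻¹(t_j)) − f(h₀⁻¹(t_{j₀})) | over j ∈ {0, …, n}. Then h(h₀⁻¹(t − (b−a)/n)) − (b−a)/n ≤ T ≤ h(h₀⁻¹(t + (b−a)/n)) + (b−a)/n. -/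
open Set Filter

/-- A right inverse of a strictly monotone self-map of a set is strictly monotone there. -/
theorem StrictMonoOn.strictMonoOn_of_rightInverse {s : Set ℝ} {h g : ℝ → ℝ}
    (hm : StrictMonoOn h s) (hg : ∀ x ∈ s, g x ∈ s ∧ h (g x) = x) : StrictMonoOn g s := by
  intro x hx y hy hxy
  rw [← hm.lt_iff_lt (hg x hx).1 (hg y hy).1, (hg x hx).2, (hg y hy).2]
  exact hxy

/-- Points of the equispaced grid lie in the interval. -/
theorem equispaced_grid_mem_Icc {a b : ℝ} (hab : a < b) {n k : ℕ} (hn : 1 ≤ n) (hk : k ≤ n) :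
    a + k * (b - a) / n ∈ Icc a b := by
  have hn' : (0 : ℝ) < n := by exact_mod_cast hn
  have hk' : (k : ℝ) ≤ n := by exact_mod_cast hk
  have hba : 0 < b - a := sub_pos.2 hab
  constructor
  · have : 0 ≤ k * (b - a) / n := by positivity
    linarith
  · have : k * (b - a) / n ≤ b - a := by
      rw [div_le_iff₀ hn']
      nlinarith
    linarith

/-- If a grid index minimizes the distance of `F (t_j)` to `F v` with `F` strictly increasing,
then `t_j` is within one mesh width of `v`. -/
theorem StrictMonoOn.abs_sub_le_of_grid_argmin {a b : ℝ} (hab : a < b) {F : ℝ → ℝ}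
    (hF : StrictMonoOn F (Icc a b)) {n : ℕ} (hn : 1 ≤ n) {v : ℝ} (hv : v ∈ Icc a b)
    {j : ℕ} (hj : j ≤ n)
    (hmin : ∀ k ≤ n, |F (a + j * (b - a) / n) - F v| ≤ |F (a + k * (b - a) / n) - F v|) :
    |a + j * (b - a) / n - v| ≤ (b - a) / n := by
  have hn' : (0 : ℝ) < n := by exact_mod_cast hn
  have hd : 0 < (b - a) / n := div_pos (sub_pos.2 hab) hn'
  have hJ := equispaced_grid_mem_Icc hab hn hj
  by_contra! hlt
  rcases lt_abs.1 hlt with hgt | hgt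
  · rcases j with _ | k
    · simp only [Nat.cast_zero, zero_mul, zero_div, add_zero] at hgt
      linarith [hv.1]
    · have hk : k ≤ n := by omega
      have hK := equispaced_grid_mem_Icc hab hn hk
      have hstep : a + (k + 1 : ℕ) * (b - a) / n = a + k * (b - a) / n + (b - a) / n := by
        push_cast
        ring
      have h1 := hF hv hK (by linarith)
      have h2 := hF hK hJ (by linarith)
      have h3 := hmin k hk
      rw [abs_of_pos (by linarith), abs_of_pos (by linarith)] at h3
      linarith
  · have hjn : j + 1 ≤ n := by
      rcases hj.eq_or_lt with rfl | hlt'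
      · have : a + j * (b - a) / j = b := by
          field_simp
          ring
        linarith [hv.2]
      · exact hlt'
    have hK := equispaced_grid_mem_Icc hab hn hjn
    have hstep : a + (j + 1 : ℕ) * (b - a) / n = a + j * (b - a) / n + (b - a) / n := by
      push_cast
      ring
    have h1 := hF hK hv (by linarith)
    have h2 := hF hJ hK (by linarith)
    have h3 := hmin (j + 1) hjn
    rw [abs_of_neg (by linarith), abs_of_neg (by linarith)] at h3
    linarith

/-- Deterministic sandwich bound for the discretized warping estimator:
if `j₀` minimizes `|t_j − t|` and `j*` minimizes `|f(h⁻¹(t_j)) − f(h₀⁻¹(t_{j₀}))|` over the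
equispaced grid `t_j = a + j(b−a)/n`, then
`h(h₀⁻¹(t − (b−a)/n)) − (b−a)/n ≤ t_{j*} ≤ h(h₀⁻¹(t + (b−a)/n)) + (b−a)/n`. -/
theorem grid_argmin_warping_sandwich
    {a b : ℝ} (hab : a < b)
    (f : ℝ → ℝ) (hfc : ContinuousOn f (Set.Icc a b)) (hfm : StrictMonoOn f (Set.Icc a b))
    (h h₀ : ℝ → ℝ)
    (hhc : ContinuousOn h (Set.Icc a b)) (hhm : StrictMonoOn h (Set.Icc a b))
    (hha : h a = a) (hhb : h b = b) (hhmaps : Set.MapsTo h (Set.Icc a b) (Set.Icc a b))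
    (h₀c : ContinuousOn h₀ (Set.Icc a b)) (h₀m : StrictMonoOn h₀ (Set.Icc a b))
    (h₀a : h₀ a = a) (h₀b : h₀ b = b) (h₀maps : Set.MapsTo h₀ (Set.Icc a b) (Set.Icc a b))
    (hinv h₀inv : ℝ → ℝ)
    (hhinv : ∀ t ∈ Set.Icc a b, hinv t ∈ Set.Icc a b ∧ h (hinv t) = t)
    (hh₀inv : ∀ t ∈ Set.Icc a b, h₀inv t ∈ Set.Icc a b ∧ h₀ (h₀inv t) = t)
    (n : ℕ) (hn : 1 ≤ n)
    (t : ℝ) (ht : t ∈ Set.Icc (a + (b - a) / n) (b - (b - a) / n))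
    (j₀ : ℕ) (hj₀ : j₀ ≤ n)
    (hj₀min : ∀ k ≤ n, |(a + j₀ * (b - a) / n) - t| ≤ |(a + k * (b - a) / n) - t|)
    (js : ℕ) (hjs : js ≤ n)
    (hjsmin : ∀ k ≤ n,
      |f (hinv (a + js * (b - a) / n)) - f (h₀inv (a + j₀ * (b - a) / n))| ≤
        |f (hinv (a + k * (b - a) / n)) - f (h₀inv (a + j₀ * (b - a) / n))|) :
    h (h₀inv (t - (b - a) / n)) - (b - a) / n ≤ a + js * (b - a) / n ∧
    a + js * (b - a) / n ≤ h (h₀inv (t + (b - a) / n)) + (b - a) / n := by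
  have hd : 0 < (b - a) / n := div_pos (sub_pos.2 hab) (by exact_mod_cast hn)
  have hinv_mono := hhm.strictMonoOn_of_rightInverse hhinv
  have h₀inv_mono := h₀m.strictMonoOn_of_rightInverse hh₀inv
  have hs := equispaced_grid_mem_Icc hab hn hj₀
  have hclose : |a + j₀ * (b - a) / n - t| ≤ (b - a) / n :=
    (strictMono_id.strictMonoOn (Icc a b)).abs_sub_le_of_grid_argmin hab hn
      ⟨by linarith [ht.1], by linarith [ht.2]⟩ hj₀ hj₀min
  have hu := (hh₀inv _ hs).1
  have hv := hhmaps hu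
  have hinv_h : hinv (h (h₀inv (a + j₀ * (b - a) / n))) = h₀inv (a + j₀ * (b - a) / n) :=
    hhm.injOn (hhinv _ hv).1 hu (hhinv _ hv).2
  have hF : StrictMonoOn (f ∘ hinv) (Icc a b) := hfm.comp hinv_mono fun x hx => (hhinv x hx).1
  have hT := hF.abs_sub_le_of_grid_argmin hab hn hv hjs
    (by simpa only [Function.comp_apply, hinv_h] using hjsmin)
  rw [abs_le] at hclose hT
  have hlo : t - (b - a) / n ∈ Icc a b := ⟨by linarith [ht.1], by linarith [ht.2]⟩
  have hhi : t + (b - a) / n ∈ Icc a b := ⟨by linarith [ht.1], by linarith [ht.2]⟩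
  have h1 := hhm.monotoneOn (hh₀inv _ hlo).1 hu (h₀inv_mono.monotoneOn hlo hs (by linarith))
  have h2 := hhm.monotoneOn hu (hh₀inv _ hhi).1 (h₀inv_mono.monotoneOn hs hhi (by linarith))
  constructor <;> linarith
end

section
/- Let f : [a,b] → ℝ be continuous and suppose there exist points a = s₀ < s₁ < … < s_{r+1} = b such that f is strictly monotone on each interval [s_k, s_{k+1}], k = 0, …, r. For an integer n ≥ 1 let t_j = a + j(b−a)/n, j = 0, …, n, and define Z̃_n(j) = f(t₀) + Σ_{k=1}^{j} |f(t_k) − f(t_{k−1})| and Z_n(j) = f(a) + V(f; [a, t_j]), where V(f; [a,t]) denotes the total variation of f over [a,t]. Let t ∈ [a,b] and let (j(n)) be a sequence with j(n) ∈ {0, …, n} and t_{j(n)} → t as n → ∞. Then Z̃_n(j(n)) − Z_n(j(n)) → 0 as n → ∞. -/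
open Set Filter

/-- The `k`-th point of the equispaced grid with `n` cells on `[a, b]`. -/
noncomputable def gridPoint (a b : ℝ) (n k : ℕ) : ℝ := a + (k : ℝ) * (b - a) / n

theorem gridPoint_zero (a b : ℝ) (n : ℕ) : gridPoint a b n 0 = a := by
  simp [gridPoint]

theorem gridPoint_self (a b : ℝ) {n : ℕ} (hn : n ≠ 0) : gridPoint a b n n = b := by
  have : (n : ℝ) ≠ 0 := by exact_mod_cast hn
  unfold gridPoint
  field_simp
  ring

theorem monotone_gridPoint {a b : ℝ} (hab : a ≤ b) (n : ℕ) : Monotone (gridPoint a b n) := by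
  intro k l hkl
  have : 0 ≤ b - a := sub_nonneg.2 hab
  unfold gridPoint
  gcongr

/-- The largest grid point not exceeding `x`, for `x ∈ [a, b]`. -/
noncomputable def gridFloor (a b : ℝ) (n : ℕ) (x : ℝ) : ℝ :=
  gridPoint a b n ⌊(x - a) * n / (b - a)⌋₊

theorem monotone_gridFloor {a b : ℝ} (hab : a < b) (n : ℕ) : Monotone (gridFloor a b n) := by
  intro x y hxy
  have : 0 < b - a := sub_pos.2 hab
  exact monotone_gridPoint hab.le n (Nat.floor_mono (by gcongr))

theorem mapsTo_gridFloor {a b : ℝ} (hab : a < b) (n : ℕ) :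
    MapsTo (gridFloor a b n) (Icc a b) (gridPoint a b n '' Iic n) := by
  intro x hx
  have h : 0 < b - a := sub_pos.2 hab
  refine ⟨_, ?_, rfl⟩
  refine Nat.floor_le_of_le ?_
  rw [div_le_iff₀ h, mul_comm]
  gcongr
  exact hx.2

theorem tendsto_gridFloor {a b x : ℝ} (hab : a < b) (hx : a ≤ x) :
    Tendsto (fun n => gridFloor a b n x) atTop (nhds x) := by
  have h : 0 < b - a := sub_pos.2 hab
  have hlim : Tendsto (fun n : ℕ => x - (b - a) / n) atTop (nhds x) := by
    simpa using (tendsto_const_div_atTop_nhds_zero_nat (b - a)).const_sub x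
  have key : ∀ n : ℕ, n ≠ 0 → x = a + ((x - a) * n / (b - a)) * (b - a) / n := by
    intro n hn
    have hn : (n : ℝ) ≠ 0 := by exact_mod_cast hn
    field_simp
    ring
  refine tendsto_of_tendsto_of_tendsto_of_le_of_le' hlim tendsto_const_nhds ?_ ?_ <;>
    filter_upwards [eventually_ne_atTop 0] with n hn
  · calc x - (b - a) / n = a + ((x - a) * n / (b - a) - 1) * (b - a) / n := by
          nth_rewrite 1 [key n hn]
          ring
      _ ≤ gridFloor a b n x := by
          unfold gridFloor gridPoint
          gcongr
          exact (Nat.sub_one_lt_floor _).le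
  · calc gridFloor a b n x ≤ a + ((x - a) * n / (b - a)) * (b - a) / n := by
          unfold gridFloor gridPoint
          gcongr
          exact Nat.floor_le (div_nonneg (mul_nonneg (sub_nonneg.2 hx) n.cast_nonneg) h.le)
      _ = x := (key n hn).symm

/-- The total variation of a continuous function on `[a, b]` is the limit of its variations along
equispaced grids. -/
theorem tendsto_sum_edist_gridPoint {E : Type*} [PseudoEMetricSpace E] {a b : ℝ} (hab : a < b)
    {f : ℝ → E} (hf : ContinuousOn f (Icc a b)) :
    Tendsto (fun n : ℕ => ∑ k ∈ Finset.range n,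
        edist (f (gridPoint a b n (k + 1))) (f (gridPoint a b n k)))
      atTop (nhds (eVariationOn f (Icc a b))) := by
  have hmem : ∀ n : ℕ, n ≠ 0 → ∀ k ≤ n, gridPoint a b n k ∈ Icc a b := fun n hn k hk =>
    ⟨(gridPoint_zero a b n).symm.trans_le (monotone_gridPoint hab.le n k.zero_le),
      (monotone_gridPoint hab.le n hk).trans_eq (gridPoint_self a b hn)⟩
  refine tendsto_order.2 ⟨fun v hv => ?_, fun v hv => ?_⟩
  · have hlim : ∀ x ∈ Icc a b,
        Tendsto (fun n => (f ∘ gridFloor a b n) x) atTop (nhds (f x)) := by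
      intro x hx
      refine (hf x hx).tendsto.comp
        (tendsto_nhdsWithin_iff.2 ⟨tendsto_gridFloor hab hx.1, ?_⟩)
      filter_upwards [eventually_ne_atTop 0] with n hn
      obtain ⟨k, hk, hkx⟩ := mapsTo_gridFloor hab n hx
      exact hkx ▸ hmem n hn k hk
    filter_upwards [eVariationOn.lowerSemicontinuous_aux hlim hv] with n hn
    refine hn.trans_le ?_
    refine (eVariationOn.comp_le_of_monotoneOn f _ ((monotone_gridFloor hab n).monotoneOn _)
      (mapsTo_gridFloor hab n)).trans_eq ?_
    rw [eVariationOn.image_range_of_monotone f (monotone_gridPoint hab.le n)]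
    simp_rw [edist_comm]
  · filter_upwards [eventually_ne_atTop 0] with n hn
    exact (eVariationOn.sum_le_of_monotoneOn_Iic ((monotone_gridPoint hab.le n).monotoneOn _)
      (hmem n hn)).trans_lt hv

theorem AntitoneOn.locallyBoundedVariationOn {f : ℝ → ℝ} {s : Set ℝ} (hf : AntitoneOn f s) :
    LocallyBoundedVariationOn f s := by
  intro x y hx hy
  have hid : eVariationOn id (Icc (f y) (f x)) ≠ ⊤ := by
    rcases le_or_gt (f y) (f x) with h | h
    · simp
    · simp [Icc_eq_empty h.not_ge]
  refine ne_top_of_le_ne_top hid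
    (eVariationOn.comp_le_of_antitoneOn id f (hf.mono inter_subset_left) ?_)
  exact fun z hz => ⟨hf hz.1 hy hz.2.2, hf hx hz.1 hz.2.1⟩

/-- A function that is monotone or antitone on each cell of a partition has bounded variation. -/
theorem boundedVariationOn_of_piecewise_monotoneOn {f : ℝ → ℝ} {s : ℕ → ℝ} {m : ℕ}
    (hs : ∀ k < m, s k ≤ s (k + 1))
    (hf : ∀ k < m, MonotoneOn f (Icc (s k) (s (k + 1))) ∨ AntitoneOn f (Icc (s k) (s (k + 1)))) :
    BoundedVariationOn f (Icc (s 0) (s m)) := by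
  suffices H : ∀ k ≤ m, s 0 ≤ s k ∧ BoundedVariationOn f (Icc (s 0) (s k)) from (H m le_rfl).2
  intro k
  induction k with
  | zero => exact fun _ => ⟨le_rfl, .of_subsingleton (by simp)⟩
  | succ k ih =>
    intro hk
    obtain ⟨h0, hV⟩ := ih (by lia)
    have hle := hs k hk
    have hcell : BoundedVariationOn f (Icc (s k) (s (k + 1))) := by
      have hloc : LocallyBoundedVariationOn f (Icc (s k) (s (k + 1))) :=
        (hf k hk).elim (fun h => h.locallyBoundedVariationOn)
          (fun h => h.locallyBoundedVariationOn)
      simpa [BoundedVariationOn] using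
        hloc _ _ (left_mem_Icc.2 hle) (right_mem_Icc.2 hle)
    refine ⟨h0.trans hle, ?_⟩
    have hadd := eVariationOn.Icc_add_Icc f (s := univ) h0 hle (mem_univ _)
    simp only [univ_inter] at hadd
    rw [BoundedVariationOn, ← hadd]
    exact ENNReal.add_ne_top.2 ⟨hV, hcell⟩

/-- The defect of the variation along a grid is nonnegative and increases with the number of
cells taken into account. -/
theorem variation_sub_sum_gridPoint_mem_Icc {f : ℝ → ℝ} {a b : ℝ} (hab : a ≤ b)
    (hV : BoundedVariationOn f (Icc a b)) {n j : ℕ} (hn : n ≠ 0) (hj : j ≤ n) :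
    (eVariationOn f (Icc a (gridPoint a b n j))).toReal -
        ∑ k ∈ Finset.range j, |f (gridPoint a b n (k + 1)) - f (gridPoint a b n k)| ∈
      Icc 0 ((eVariationOn f (Icc a b)).toReal -
        ∑ k ∈ Finset.range n, |f (gridPoint a b n (k + 1)) - f (gridPoint a b n k)|) := by
  have hmono := monotone_gridPoint hab n
  have h0 : a ≤ gridPoint a b n j := (gridPoint_zero a b n).symm.trans_le (hmono j.zero_le)
  have h1 : gridPoint a b n j ≤ b := (hmono hj).trans_eq (gridPoint_self a b hn)
  have hVl := hV.mono (Icc_subset_Icc_right h1)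
  have hVr := hV.mono (Icc_subset_Icc_left h0)
  have hadd := eVariationOn.Icc_add_Icc f (s := univ) h0 h1 (mem_univ _)
  simp only [univ_inter] at hadd
  have hsum : ∀ {i l : ℕ} {c d : ℝ}, c ≤ gridPoint a b n i → gridPoint a b n l ≤ d →
      BoundedVariationOn f (Icc c d) →
      ∑ k ∈ Finset.Ico i l, |f (gridPoint a b n (k + 1)) - f (gridPoint a b n k)| ≤
        (eVariationOn f (Icc c d)).toReal := by
    intro i l c d hc hd hcd
    have := ENNReal.toReal_mono hcd (eVariationOn.sum_le_of_monotoneOn_Icc (f := f)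
      (hmono.monotoneOn (Icc i l)) fun k hk => ⟨hc.trans (hmono hk.1), (hmono hk.2).trans hd⟩)
    rw [ENNReal.toReal_sum fun _ _ => edist_ne_top _ _] at this
    simpa only [← dist_edist, Real.dist_eq] using this
  have hl := hsum (i := 0) (gridPoint_zero a b n).ge le_rfl hVl
  have hr := hsum le_rfl (gridPoint_self a b hn).le hVr
  rw [← Finset.range_eq_Ico] at hl
  rw [← hadd, ENNReal.toReal_add hVl hVr, ← Finset.sum_range_add_sum_Ico _ hj]
  constructor <;> linarith

/-- Let `f : [a,b] → ℝ` be continuous and piecewise strictly monotone on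
the intervals determined by `a = s 0 < … < s (r+1) = b`. For the equispaced grid
`t_j = a + j(b−a)/n`, let `Z̃_n(j) = f(t_0) + ∑_{k=1}^{j} |f(t_k) − f(t_{k−1})|` and
`Z_n(j) = f(a) + V(f; [a, t_j])`. If `j n ≤ n` and `t_{j n} → t`, then
`Z̃_n(j n) − Z_n(j n) → 0` as `n → ∞`. -/
theorem discretized_monotonization_consistent
    {a b : ℝ} (hab : a < b)
    (f : ℝ → ℝ) (hfc : ContinuousOn f (Set.Icc a b))
    (r : ℕ) (s : ℕ → ℝ)
    (hs0 : s 0 = a) (hsr : s (r + 1) = b)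
    (hsmono : ∀ k ≤ r, s k < s (k + 1))
    (hpiece : ∀ k ≤ r, StrictMonoOn f (Set.Icc (s k) (s (k + 1))) ∨
      StrictAntiOn f (Set.Icc (s k) (s (k + 1))))
    (t : ℝ) (ht : t ∈ Set.Icc a b)
    (j : ℕ → ℕ) (hj : ∀ n, j n ≤ n)
    (hjt : Filter.Tendsto (fun n : ℕ => a + (j n : ℝ) * (b - a) / n)
      Filter.atTop (nhds t)) :
    Filter.Tendsto (fun n : ℕ =>
        (f a + ∑ k ∈ Finset.range (j n),
          |f (a + ((k : ℝ) + 1) * (b - a) / n) - f (a + (k : ℝ) * (b - a) / n)|) -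
        (f a + (eVariationOn f (Set.Icc a (a + (j n : ℝ) * (b - a) / n))).toReal))
      Filter.atTop (nhds 0) := by
  have hV : BoundedVariationOn f (Icc a b) := by
    rw [← hs0, ← hsr]
    exact boundedVariationOn_of_piecewise_monotoneOn
      (fun k hk => (hsmono k (Nat.lt_succ_iff.1 hk)).le)
      fun k hk => (hpiece k (Nat.lt_succ_iff.1 hk)).imp
        StrictMonoOn.monotoneOn StrictAntiOn.antitoneOn
  have hlim : Tendsto (fun n : ℕ => (eVariationOn f (Icc a b)).toReal -
      ∑ k ∈ Finset.range n, |f (gridPoint a b n (k + 1)) - f (gridPoint a b n k)|)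
      atTop (nhds 0) := by
    have h := ((ENNReal.tendsto_toReal hV).comp (tendsto_sum_edist_gridPoint hab hfc)).const_sub
      (eVariationOn f (Icc a b)).toReal
    rw [sub_self] at h
    refine h.congr fun n => ?_
    simp only [Function.comp_apply]
    rw [ENNReal.toReal_sum fun _ _ => edist_ne_top _ _]
    simp only [← dist_edist, Real.dist_eq]
  have hdefect : ∀ᶠ n in atTop, _ := (eventually_ne_atTop 0).mono fun n hn =>
    variation_sub_sum_gridPoint_mem_Icc hab.le hV hn (hj n)
  have hzero := tendsto_of_tendsto_of_tendsto_of_le_of_le' tendsto_const_nhds hlim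
    (hdefect.mono fun _ h => h.1) (hdefect.mono fun _ h => h.2)
  rw [← neg_zero]
  refine hzero.neg.congr fun n => ?_
  simp only [gridPoint, Nat.cast_add, Nat.cast_one]
  ring
end
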